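/- arXiv:2105.09383 — 2 statements merged into one kernel-verified Lean document; each statement's English description precedes it below -/
import Mathlib

section
/- Let n ≥ 4 and d ≥ 2 be integers, and let S and T_ε be the order-d tensors with dimensions n×…×n defined in the context (T_ε depending on a parameter ε > 0). Then there exists ε₀ > 0 such that for every ε ∈ (0, ε₀): all entries of S + T_ε are nonnegative, and for every collection of pairwise disjoint subsets P_1, …, P_n of supp(S + T_ε) = {x : (S + T_ε)(x) ≠ 0} whose union is supp(S + T_ε) and whose (S + T_ε)-sums are all equal, there exists a single index j ∈ {1,…,d} with {P_1, …, P_n} = { supp(S + T_ε) ∩ {x : x_j = i} : i ∈ {1,…,n} }; i.e., the only equi-partitions of the nonzero entries of S + T_ε correspond to aligned slices. -/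
open Finset

/-- The order-`d` tensor `S` with dimensions `n × ⋯ × n` (indices are 0-based,
so the paper's index `i ∈ {1,…,n}` corresponds to the `Fin n` value `i - 1`). -/
noncomputable def tensorS (n d : ℕ) (hn : 1 ≤ n) (x : Fin d → Fin n) : ℝ :=
  (∑ c : Fin (n - 1),
    if x = (fun _ => Fin.castLE (Nat.sub_le n 1) c) then
      ((d : ℝ) ^ (n - 1 - (c : ℕ)) - 1) / (d : ℝ) ^ (n - 1 - (c : ℕ)) else 0)
  + (∑ c : Fin (n - 1), ∑ j : Fin d,
    if x = (fun j' => if j' = j then (⟨n - 1, by omega⟩ : Fin n)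
        else Fin.castLE (Nat.sub_le n 1) c) then
      (1 / ((d : ℝ) - 1)) * (1 / (d : ℝ) ^ (n - 1 - (c : ℕ))) else 0)
  + (if x = (fun _ => (⟨n - 1, by omega⟩ : Fin n)) then
      1 - ∑ c ∈ Finset.range (n - 1), (1 / ((d : ℝ) - 1)) * (1 / (d : ℝ) ^ (n - 1 - c)) else 0)


/-- `r_{ij} = ε^{d(n−1) − d·i − j + 1}` (with a possibly negative integer exponent). -/
noncomputable def rr (n d : ℕ) (ε : ℝ) (i j : ℕ) : ℝ :=
  ε ^ ((d : ℤ) * ((n : ℤ) - 1) - (d : ℤ) * (i : ℤ) - (j : ℤ) + 1)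

/-- `u_{1j} = r_{1j}` and
`u_{ij} = (1/(d−1))·Σ_{k≠j} (−u_{i−1,k}) + ((d−2)/(d−1))·u_{i−1,j} + r_{ij}`. -/
noncomputable def uu (n d : ℕ) (ε : ℝ) : ℕ → ℕ → ℝ
  | 0, _ => 0
  | 1, j => rr n d ε 1 j
  | i + 2, j =>
      (1 / ((d : ℝ) - 1)) * (∑ k ∈ (Finset.Icc 1 d).erase j, -(uu n d ε (i + 1) k))
      + (((d : ℝ) - 2) / ((d : ℝ) - 1)) * uu n d ε (i + 1) j
      + rr n d ε (i + 2) j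

/-- `ξ_j = u_{n−1,j} − r_{n−1,j}`. -/
noncomputable def xiT (n d : ℕ) (ε : ℝ) (j : ℕ) : ℝ :=
  uu n d ε (n - 1) j - rr n d ε (n - 1) j

/-- `z₁ = (Σ_{i=1}^{n−2} r_{i1}) − ξ₁`. -/
noncomputable def zT (n d : ℕ) (ε : ℝ) : ℝ :=
  (∑ i ∈ Finset.Icc 1 (n - 2), rr n d ε i 1) - xiT n d ε 1

/-- The order-`d` perturbation tensor `T_ε` with dimensions `n × ⋯ × n` (0-based indices:
the paper's index `i ∈ {1,…,n}` corresponds to the `Fin n` value `i - 1`). -/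
noncomputable def tensorT (n d : ℕ) (ε : ℝ) (hn : 1 ≤ n) (x : Fin d → Fin n) : ℝ :=
  (∑ c : Fin (n - 2), ∑ j : Fin d,
    if x = (fun j' => if j' = j then (⟨n - 1, by omega⟩ : Fin n)
        else Fin.castLE (by omega : n - 2 ≤ n) c) then
      -(rr n d ε ((c : ℕ) + 1) ((j : ℕ) + 1)) else 0)
  + (∑ c : Fin (n - 2), ∑ j : Fin d,
    if x = (fun j' => if j' = j then (⟨(c : ℕ) + 1, by have := c.isLt; omega⟩ : Fin n)
        else Fin.castLE (by omega : n - 2 ≤ n) c) then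
      uu n d ε ((c : ℕ) + 1) ((j : ℕ) + 1) else 0)
  + (∑ j : Fin d,
    if x = (fun j' => if j' = j then (⟨n - 1, by omega⟩ : Fin n)
        else (⟨n - 2, by omega⟩ : Fin n)) then
      xiT n d ε ((j : ℕ) + 1) else 0)
  + (if x = (fun _ => (⟨n - 1, by omega⟩ : Fin n)) then zT n d ε else 0)


lemma tz_geom (D : ℤ) (k : ℕ) : (D - 1) * ∑ c ∈ range k, D ^ c = D ^ k - 1 := by
  rw [mul_comm]; exact geom_sum_mul D k

lemma tz_geom_le (D : ℤ) (hD : 2 ≤ D) (k : ℕ) : ∑ c ∈ range k, D ^ c ≤ D ^ k - 1 := by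
  have h := tz_geom D k
  have h2 : 0 ≤ ∑ c ∈ range k, D ^ c := Finset.sum_nonneg fun i _ => by positivity
  nlinarith

lemma tz_lower (D : ℤ) (hD : 2 ≤ D) (A : ℕ → ℤ) (k : ℕ) (h0 : ∀ c < k, 0 ≤ A c) :
    -(D ^ k - 1) ≤ ∑ c ∈ range k, (A c - 1) * D ^ c := by
  have h := tz_geom_le D hD k
  have : ∑ c ∈ range k, -(D ^ c) ≤ ∑ c ∈ range k, (A c - 1) * D ^ c := by
    apply Finset.sum_le_sum
    intro i hi
    have := h0 i (Finset.mem_range.1 hi)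
    have : (0:ℤ) < D ^ i := by positivity
    nlinarith
  rw [Finset.sum_neg_distrib] at this
  linarith

lemma tz_upper (D : ℤ) (hD : 2 ≤ D) (A : ℕ → ℤ) (k : ℕ) (h0 : ∀ c < k, A c ≤ D - 1) :
    ∑ c ∈ range k, A c * D ^ c ≤ D ^ k - 1 := by
  rw [← tz_geom, Finset.mul_sum]
  apply Finset.sum_le_sum
  intro i hi
  have := h0 i (Finset.mem_range.1 hi)
  have : (0:ℤ) < D ^ i := by positivity
  nlinarith

lemma tz_digits (D : ℤ) (hD : 2 ≤ D) (A : ℕ → ℤ) (t : ℕ) : ∀ m : ℕ, t ≤ m →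
    (∀ c ≤ m, 0 ≤ A c) → (∀ c ≤ m, A c ≤ D - 1) →
    ∑ c ∈ range (m + 1), A c * D ^ c = (D - 1) * D ^ t →
    A t = D - 1 ∧ ∀ c ≤ m, c ≠ t → A c = 0 := by
  intro m
  induction m with
  | zero =>
    intro ht h0 h1 hs
    have : t = 0 := by omega
    subst this
    simp at hs
    refine ⟨by linarith, fun c hc hc' => by omega⟩
  | succ m ih =>
    intro ht h0 h1 hs
    rw [Finset.sum_range_succ] at hs
    have hpos : (0:ℤ) < D ^ (m + 1) := by positivity
    have hnn : ∀ c ∈ range (m + 1), 0 ≤ A c * D ^ c := fun c hc => by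
      have := h0 c (by have := Finset.mem_range.1 hc; omega)
      positivity
    have hsn := Finset.sum_nonneg hnn
    rcases Nat.lt_or_ge t (m + 1) with h | h
    · have hz : A (m + 1) = 0 := by
        by_contra hne
        have h2 := h0 (m + 1) le_rfl
        have h3 : 1 ≤ A (m + 1) := by omega
        have h4 : D ^ (t + 1) ≤ D ^ (m + 1) := pow_le_pow_right₀ (by linarith) (by omega)
        have h5 : (0:ℤ) < D ^ t := by positivity
        rw [pow_succ] at h4
        nlinarith
      rw [hz] at hs
      have := ih (by omega) (fun c hc => h0 c (by omega)) (fun c hc => h1 c (by omega)) (by linarith)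
      refine ⟨this.1, fun c hc hct => ?_⟩
      rcases Nat.lt_or_ge c (m + 1) with h' | h'
      · exact this.2 c (by omega) hct
      · have : c = m + 1 := by omega
        rw [this, hz]
    · have : t = m + 1 := by omega
      subst this
      have hu := tz_upper D hD A (m + 1) (fun c hc => h1 c (by omega))
      have h2 := h1 (m + 1) le_rfl
      have h3 : A (m + 1) = D - 1 := by
        by_contra hne
        have : A (m + 1) ≤ D - 2 := by omega
        nlinarith
      refine ⟨h3, fun c hc hct => ?_⟩
      rw [h3] at hs
      have hs0 : ∑ c ∈ range (m + 1), A c * D ^ c = 0 := by linarith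
      have := (Finset.sum_eq_zero_iff_of_nonneg hnn).1 hs0 c (Finset.mem_range.2 (by omega))
      rcases mul_eq_zero.1 this with h | h
      · exact h
      · have : (0:ℤ) < D ^ c := by positivity
        omega

lemma tz_corner_aux (D : ℤ) (hD : 2 ≤ D) (A : ℕ → ℤ) : ∀ k : ℕ, (∀ c ≤ k, 0 ≤ A c) → 1 ≤ A k →
    (∀ c < k, A (c + 1) = 1 → 1 ≤ A c) → ∑ c ∈ range (k + 1), (A c - 1) * D ^ c = 0 →
    ∀ c ≤ k, A c = 1 := by
  intro k
  induction k with
  | zero =>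
    intro _ _ _ hs c hc
    have : c = 0 := by omega
    subst this
    simp at hs
    linarith
  | succ k ih =>
    intro h0 h1 hch hs
    rw [Finset.sum_range_succ] at hs
    have hl := tz_lower D hD A (k + 1) (fun c hc => h0 c (by omega))
    have hpos : (0:ℤ) < D ^ (k + 1) := by positivity
    have hA : A (k + 1) = 1 := by
      by_contra hne
      have : 2 ≤ A (k + 1) := by omega
      nlinarith
    rw [hA] at hs
    have := ih (fun c hc => h0 c (by omega)) (hch k (by omega) hA)
      (fun c hc => hch c (by omega)) (by linarith)
    intro c hc
    rcases Nat.lt_or_ge c (k + 1) with h' | h'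
    · exact this c (by omega)
    · have : c = k + 1 := by omega
      rw [this, hA]

lemma tz_corner (D : ℤ) (hD : 2 ≤ D) (A : ℕ → ℤ) (m : ℕ) (h0 : ∀ c ≤ m + 1, 0 ≤ A c)
    (h1 : ∀ c ≤ m + 1, A c ≤ D) (htop : A (m + 1) = 0 → A m = D)
    (hch : ∀ c < m + 1, A (c + 1) = 1 → 1 ≤ A c)
    (hs : ∑ c ∈ range (m + 2), (A c - 1) * D ^ c = 0) : ∀ c ≤ m + 1, A c = 1 := by
  refine tz_corner_aux D hD A (m + 1) h0 ?_ hch hs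
  by_contra hne
  have hz : A (m + 1) = 0 := by have := h0 (m + 1) le_rfl; omega
  have hm := htop hz
  rw [Finset.sum_range_succ, Finset.sum_range_succ, hz, hm] at hs
  have := tz_upper D hD (fun c => A c - 1) m (fun c hc => by have := h1 c (by omega); simp; omega)
  rw [pow_succ] at hs
  nlinarith

lemma tz_noDiag (D : ℤ) (hD : 2 ≤ D) (A : ℕ → ℤ) (m t : ℕ) (ht : t ≤ m + 1)
    (h0 : ∀ c ≤ m + 1, 0 ≤ A c) (htop : A (m + 1) = 0 → A m = D)
    (hs : ∑ c ∈ range (m + 2), (A c - 1) * D ^ c = - ((D - 1) * (D ^ (m + 2) - D ^ t))) :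
    False := by
  have hl := tz_lower D hD A m (fun c hc => h0 c (by omega))
  rw [Finset.sum_range_succ, Finset.sum_range_succ] at hs
  have hpos : (0:ℤ) < D ^ m := by positivity
  have h4 : D ^ t ≤ D ^ (m + 1) := pow_le_pow_right₀ (by linarith) (by omega)
  have e1 : D ^ (m + 1) = D ^ m * D := pow_succ _ _
  have e2 : D ^ (m + 2) = D ^ m * D * D := by ring
  have h5 : -(D ^ m) ≤ (A m - 1) * D ^ m + (A (m + 1) - 1) * D ^ (m + 1) := by
    by_cases hz : A (m + 1) = 0
    · rw [hz, htop hz, e1]; nlinarith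
    · have := h0 (m + 1) le_rfl
      have h6 : 1 ≤ A (m + 1) := by omega
      have := h0 m (by omega)
      have : (0:ℤ) < D ^ (m + 1) := by positivity
      nlinarith
  have h7 : (D - 1) * (D ^ (m + 2) - D ^ (m+1)) ≤ (D - 1) * (D ^ (m + 2) - D ^ t) := by
    apply mul_le_mul_of_nonneg_left <;> linarith
  have h8 : D ^ m * D ≤ (D - 1) * (D ^ (m + 2) - D ^ (m+1)) := by
    rw [e1, e2]
    have : (D - 1) * (D ^ m * D * D - D ^ m * D) = (D ^ m * D) * ((D - 1) * (D - 1)) := by ring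
    rw [this]
    have : 1 ≤ (D - 1) * (D - 1) := by nlinarith
    have : 0 < D ^ m * D := by positivity
    nlinarith
  nlinarith

section core
variable {m d : ℕ}

def pD (m d : ℕ) (c : Fin (m + 2)) : Fin d → Fin (m + 3) := fun _ => c.castSucc
def pA (m d : ℕ) (c : Fin (m + 2)) (j : Fin d) : Fin d → Fin (m + 3) :=
  fun j' => if j' = j then Fin.last (m + 2) else c.castSucc
def pB (m d : ℕ) (c : Fin (m + 1)) (j : Fin d) : Fin d → Fin (m + 3) :=
  fun j' => if j' = j then c.succ.castSucc else c.castSucc.castSucc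
def pC (m d : ℕ) : Fin d → Fin (m + 3) := fun _ => Fin.last (m + 2)
def iz (Q : Finset (Fin d → Fin (m + 3))) (x : Fin d → Fin (m + 3)) : ℤ := if x ∈ Q then 1 else 0
def sA (Q : Finset (Fin d → Fin (m + 3))) (c : Fin (m + 2)) : ℤ := ∑ j, iz Q (pA m d c j)

lemma iz_nonneg (Q : Finset (Fin d → Fin (m + 3))) (x) : 0 ≤ iz Q x := by
  unfold iz; split_ifs <;> simp
lemma iz_le (Q : Finset (Fin d → Fin (m + 3))) (x) : iz Q x ≤ 1 := by
  unfold iz; split_ifs <;> simp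
lemma iz_one {Q : Finset (Fin d → Fin (m + 3))} {x} (h : x ∈ Q) : iz Q x = 1 := by simp [iz, h]
lemma iz_zero {Q : Finset (Fin d → Fin (m + 3))} {x} (h : x ∉ Q) : iz Q x = 0 := by simp [iz, h]
lemma mem_of_iz {Q : Finset (Fin d → Fin (m + 3))} {x} (h : 1 ≤ iz Q x) : x ∈ Q := by
  by_contra hn; rw [iz_zero hn] at h; omega
lemma sA_nonneg (Q : Finset (Fin d → Fin (m + 3))) (c) : 0 ≤ sA Q c :=
  Finset.sum_nonneg fun _ _ => iz_nonneg _ _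
lemma sA_le (Q : Finset (Fin d → Fin (m + 3))) (c) : sA Q c ≤ d := by
  unfold sA
  calc _ ≤ ∑ j : Fin d, (1:ℤ) := Finset.sum_le_sum fun _ _ => iz_le _ _
    _ = d := by simp

/-- extension of `sA` to natural number levels -/
def sN (Q : Finset (Fin d → Fin (m + 3))) (c : ℕ) : ℤ := if h : c < m + 2 then sA Q ⟨c, h⟩ else 0

lemma sN_val (Q : Finset (Fin d → Fin (m + 3))) (c : Fin (m + 2)) : sN Q c = sA Q c := by
  simp [sN]
lemma sN_nonneg (Q : Finset (Fin d → Fin (m + 3))) (c) : 0 ≤ sN Q c := by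
  unfold sN; split_ifs
  · exact sA_nonneg _ _
  · simp
lemma sN_le (Q : Finset (Fin d → Fin (m + 3))) (c) : sN Q c ≤ d := by
  unfold sN; split_ifs
  · exact sA_le _ _
  · simp

/-- the scaled sum condition -/
def condS (Q : Finset (Fin d → Fin (m + 3))) : Prop :=
  ∑ c : Fin (m + 2), iz Q (pD m d c) * (((d:ℤ) - 1) * ((d:ℤ) ^ (m + 2) - (d:ℤ) ^ (c:ℕ)))
    + ∑ c : Fin (m + 2), sA Q c * (d:ℤ) ^ (c:ℕ)
    + iz Q (pC m d) * (((d:ℤ) - 1) * (d:ℤ) ^ (m + 2) - ∑ c : Fin (m + 2), (d:ℤ) ^ (c:ℕ))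
    = ((d:ℤ) - 1) * (d:ℤ) ^ (m + 2)

/-- the perturbation condition -/
def condT (Q : Finset (Fin d → Fin (m + 3))) : Prop :=
  ∀ (c : Fin (m + 1)) (k : Fin d), ((d:ℤ) - 1) * iz Q (pB m d c k)
    = ((d:ℤ) - 1) * (iz Q (pA m d c.castSucc k) - iz Q (pA m d c.succ k))
      + sA Q c.succ - iz Q (pC m d)

lemma geomFin_le (hd : 2 ≤ d) :
    ∑ c : Fin (m + 2), (d:ℤ) ^ (c:ℕ) ≤ (d:ℤ) ^ (m + 2) - 1 := by
  have := tz_geom_le (d:ℤ) (by exact_mod_cast hd) (m + 2)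
  rwa [Finset.sum_range] at this

lemma pow_lt_top (hd : 2 ≤ d) (c : Fin (m + 2)) : (d:ℤ) ^ (c:ℕ) < (d:ℤ) ^ (m + 2) :=
  pow_lt_pow_right₀ (by exact_mod_cast (by omega : 1 < d)) c.isLt

/-- no two diagonal entries in the same part -/
lemma diag_unique (hd : 2 ≤ d) {Q : Finset (Fin d → Fin (m + 3))} (hS : condS Q)
    {s t : Fin (m + 2)} (hs : pD m d s ∈ Q) (ht : pD m d t ∈ Q) : s = t := by
  by_contra hne
  wlog hlt : s < t generalizing s t
  · exact this ht hs (Ne.symm hne) (lt_of_le_of_ne (not_lt.1 hlt) (Ne.symm hne))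
  have hD : (2:ℤ) ≤ d := by exact_mod_cast hd
  unfold condS at hS
  have h1 : ∑ c ∈ ({s, t} : Finset (Fin (m + 2))),
      iz Q (pD m d c) * (((d:ℤ) - 1) * ((d:ℤ) ^ (m + 2) - (d:ℤ) ^ (c:ℕ))) ≤
      ∑ c : Fin (m + 2), iz Q (pD m d c) * (((d:ℤ) - 1) * ((d:ℤ) ^ (m + 2) - (d:ℤ) ^ (c:ℕ))) := by
    apply Finset.sum_le_sum_of_subset_of_nonneg (Finset.subset_univ _)
    intro i _ _
    have := pow_lt_top hd i
    exact mul_nonneg (iz_nonneg _ _) (mul_nonneg (by linarith) (by linarith))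
  rw [Finset.sum_pair hne, iz_one hs, iz_one ht] at h1
  have h2 : 0 ≤ ∑ c : Fin (m + 2), sA Q c * (d:ℤ) ^ (c:ℕ) :=
    Finset.sum_nonneg fun c _ => mul_nonneg (sA_nonneg _ _) (by positivity)
  have hp : (0:ℤ) < (d:ℤ) ^ (m + 2) := by positivity
  have h3 : 0 ≤ iz Q (pC m d) * (((d:ℤ) - 1) * (d:ℤ) ^ (m + 2) - ∑ c : Fin (m + 2), (d:ℤ) ^ (c:ℕ)) := by
    apply mul_nonneg (iz_nonneg _ _)
    have := geomFin_le (m := m) hd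
    nlinarith
  have h4 : (d:ℤ) ^ (s:ℕ) + (d:ℤ) ^ (t:ℕ) < (d:ℤ) ^ (m + 2) := by
    have h5 : (d:ℤ) ^ (s:ℕ) < (d:ℤ) ^ (t:ℕ) := pow_lt_pow_right₀ (by linarith) hlt
    have h6 : (d:ℤ) ^ ((t:ℕ) + 1) ≤ (d:ℤ) ^ (m + 2) :=
      pow_le_pow_right₀ (by linarith) (by have := t.isLt; omega)
    rw [pow_succ] at h6
    have : (0:ℤ) < (d:ℤ) ^ (t:ℕ) := by positivity
    nlinarith
  nlinarith

lemma sum_single_diag {Q : Finset (Fin d → Fin (m + 3))} (t : Fin (m + 2)) (F : Fin (m + 2) → ℤ)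
    (h : ∀ c, pD m d c ∈ Q ↔ c = t) : ∑ c, iz Q (pD m d c) * F c = F t := by
  rw [Finset.sum_eq_single t]
  · rw [iz_one ((h t).2 rfl)]; ring
  · intro b _ hb
    rw [iz_zero (fun hh => hb ((h b).1 hh))]; ring
  · simp

lemma sub_one_sum (Q : Finset (Fin d → Fin (m + 3))) :
    ∑ c ∈ range (m + 2), (sN Q c - 1) * (d:ℤ) ^ c =
    ∑ c : Fin (m + 2), sA Q c * (d:ℤ) ^ (c:ℕ) - ∑ c : Fin (m + 2), (d:ℤ) ^ (c:ℕ) := by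
  rw [Finset.sum_range, ← Finset.sum_sub_distrib]
  refine Finset.sum_congr rfl fun c _ => ?_
  rw [sN_val]; ring

lemma corner_top (hd : 2 ≤ d) {Q : Finset (Fin d → Fin (m + 3))} (hT : condT Q)
    (hc : pC m d ∈ Q) : sN Q (m + 1) = 0 → sN Q m = d := by
  intro h
  have e1 : sN Q (m + 1) = sA Q (Fin.last m).succ := by
    rw [← sN_val]; simp
  have e2 : sN Q m = sA Q (Fin.last m).castSucc := by
    rw [← sN_val]; simp
  rw [e1] at h
  rw [e2]
  have hD : (2:ℤ) ≤ d := by exact_mod_cast hd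
  have : ∀ k, iz Q (pA m d (Fin.last m).castSucc k) = 1 := by
    intro k
    have := hT (Fin.last m) k
    rw [h, iz_one hc] at this
    have h1 := iz_nonneg Q (pB m d (Fin.last m) k)
    have h2 := iz_nonneg Q (pA m d (Fin.last m).succ k)
    have h3 := iz_le Q (pA m d (Fin.last m).castSucc k)
    by_contra hne
    have h4 : iz Q (pA m d (Fin.last m).castSucc k) ≤ 0 := by omega
    nlinarith
  unfold sA
  simp [this]

lemma corner_noDiag (hd : 2 ≤ d) {Q : Finset (Fin d → Fin (m + 3))} (hS : condS Q) (hT : condT Q)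
    (hc : pC m d ∈ Q) (t : Fin (m + 2)) : pD m d t ∉ Q := by
  intro ht
  have hu : ∀ c, pD m d c ∈ Q ↔ c = t :=
    fun c => ⟨fun h => diag_unique hd hS h ht, fun h => h ▸ ht⟩
  have hD : (2:ℤ) ≤ d := by exact_mod_cast hd
  refine tz_noDiag (d:ℤ) hD (sN Q) m t (by have := t.isLt; omega) (fun c _ => sN_nonneg _ _)
    (corner_top hd hT hc) ?_
  rw [sub_one_sum]
  unfold condS at hS
  rw [sum_single_diag t _ hu, iz_one hc] at hS
  linarith

lemma corner_part (hd : 2 ≤ d) {Q : Finset (Fin d → Fin (m + 3))} (hS : condS Q) (hT : condT Q)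
    (hc : pC m d ∈ Q) : ∃ j, ∀ c, pA m d c j ∈ Q := by
  have hD : (2:ℤ) ≤ d := by exact_mod_cast hd
  have hchain : ∀ (c : Fin (m + 1)), sA Q c.succ = 1 → ∀ k, pA m d c.succ k ∈ Q →
      pA m d c.castSucc k ∈ Q := by
    intro c h k hk
    have := hT c k
    rw [h, iz_one hc, iz_one hk] at this
    have h1 := iz_nonneg Q (pB m d c k)
    apply mem_of_iz
    nlinarith
  have hex : ∀ c, sA Q c = 1 → ∃ k, pA m d c k ∈ Q := by
    intro c h
    by_contra hne
    push Not at hne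
    have : sA Q c = 0 := Finset.sum_eq_zero fun k _ => iz_zero (hne k)
    omega
  have hall : ∀ c ≤ m + 1, sN Q c = 1 := by
    refine tz_corner (d:ℤ) hD (sN Q) m (fun c _ => sN_nonneg _ _) (fun c _ => sN_le _ _)
      (corner_top hd hT hc) ?_ ?_
    · intro c hcm h
      have e1 : sN Q (c + 1) = sA Q (Fin.succ ⟨c, hcm⟩) := by rw [← sN_val]; simp
      have e2 : sN Q c = sA Q (Fin.castSucc ⟨c, hcm⟩) := by rw [← sN_val]; simp
      rw [e1] at h
      rw [e2]
      obtain ⟨k, hk⟩ := hex _ h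
      have hk' := hchain _ h k hk
      rw [← iz_one hk']
      exact Finset.single_le_sum (f := fun k => iz Q (pA m d (Fin.castSucc ⟨c, hcm⟩) k))
        (fun _ _ => iz_nonneg _ _) (Finset.mem_univ k)
    · rw [sub_one_sum]
      have hS' := hS
      unfold condS at hS'
      rw [iz_one hc, Finset.sum_eq_zero] at hS'
      · linarith
      · intro c _
        rw [iz_zero (corner_noDiag hd hS hT hc c)]; ring
  have hall' : ∀ c, sA Q c = 1 := fun c => by
    rw [← sN_val]; exact hall c (by have := c.isLt; omega)
  obtain ⟨j, hj⟩ := hex (Fin.last (m + 1)) (hall' _)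
  refine ⟨j, fun c => ?_⟩
  induction c using Fin.reverseInduction with
  | last => exact hj
  | cast i ih => exact hchain i (hall' _) j ih

lemma diag_part (hd : 2 ≤ d) {Q : Finset (Fin d → Fin (m + 3))} (hS : condS Q)
    (hc : pC m d ∉ Q) (t : Fin (m + 2)) (ht : pD m d t ∈ Q) (j : Fin d)
    (hj : ∀ c, pA m d c j ∉ Q) :
    (∀ k, k ≠ j → pA m d t k ∈ Q) ∧ sA Q t = d - 1 ∧
      ∀ c, c ≠ t → sA Q c = 0 ∧ ∀ k, pA m d c k ∉ Q := by
  have hD : (2:ℤ) ≤ d := by exact_mod_cast hd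
  have hu : ∀ c, pD m d c ∈ Q ↔ c = t :=
    fun c => ⟨fun h => diag_unique hd hS h ht, fun h => h ▸ ht⟩
  have hsum : ∀ c, sA Q c = ∑ k ∈ Finset.univ.erase j, iz Q (pA m d c k) := by
    intro c
    unfold sA
    rw [← Finset.add_sum_erase _ _ (Finset.mem_univ j), iz_zero (hj c), zero_add]
  have hcard : ∑ k ∈ Finset.univ.erase j, (1:ℤ) = d - 1 := by
    simp [Finset.card_erase_of_mem]
    omega
  have hle : ∀ c, sA Q c ≤ d - 1 := by
    intro c
    rw [hsum, ← hcard]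
    exact Finset.sum_le_sum fun _ _ => iz_le _ _
  have key := tz_digits (d:ℤ) hD (sN Q) t (m + 1) (by have := t.isLt; omega)
    (fun c _ => sN_nonneg _ _)
    (fun c hcm => by
      have := hle ⟨c, by omega⟩
      rwa [← sN_val] at this)
    (by
      unfold condS at hS
      rw [sum_single_diag t _ hu, iz_zero hc] at hS
      rw [Finset.sum_range]
      simp only [sN_val]
      linarith)
  rw [sN_val] at key
  refine ⟨?_, key.1, ?_⟩
  · intro k hk
    have h1 := key.1
    rw [hsum, ← hcard] at h1
    have := (Finset.sum_eq_sum_iff_of_le (fun _ _ => iz_le _ _)).1 h1 k (by simp [hk])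
    exact mem_of_iz this.ge
  · intro c hct
    have h0 := key.2 c (by have := c.isLt; omega) (fun h => hct (Fin.ext h))
    rw [sN_val] at h0
    refine ⟨h0, fun k hk => ?_⟩
    have := (Finset.sum_eq_zero_iff_of_nonneg (fun _ _ => iz_nonneg _ _)).1 h0 k (Finset.mem_univ k)
    rw [iz_one hk] at this
    omega

theorem core (hd : 2 ≤ d) (P : Fin (m + 3) → Finset (Fin d → Fin (m + 3)))
    (hdis : ∀ l l', l ≠ l' → Disjoint (P l) (P l'))
    (hcov : ∀ i : Fin (m + 3), ∃ l, (fun _ => i) ∈ P l)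
    (hS : ∀ l, condS (P l)) (hT : ∀ l, condT (P l)) :
    ∃ (j : Fin d) (σ : Equiv.Perm (Fin (m + 3))),
      (∀ c, pD m d c ∈ P (σ (pD m d c j))) ∧ (∀ c k, pA m d c k ∈ P (σ (pA m d c k j))) ∧
      (∀ c k, pB m d c k ∈ P (σ (pB m d c k j))) ∧ pC m d ∈ P (σ (pC m d j)) := by
  have hD : (2:ℤ) ≤ d := by exact_mod_cast hd
  choose f hf using hcov
  have hfD : ∀ c : Fin (m + 2), pD m d c ∈ P (f c.castSucc) := fun c => hf _
  have hfC : pC m d ∈ P (f (Fin.last _)) := hf _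
  have hinj : Function.Injective f := by
    intro a b hab
    induction a using Fin.lastCases with
    | last =>
      induction b using Fin.lastCases with
      | last => rfl
      | cast b => exact absurd (hab ▸ hfD b) (corner_noDiag hd (hS _) (hT _) hfC b)
    | cast a =>
      induction b using Fin.lastCases with
      | last => exact absurd (hab ▸ hfD a) (corner_noDiag hd (hS _) (hT _) hfC a)
      | cast b => rw [diag_unique hd (hS _) (hfD a) (hab ▸ hfD b)]
  obtain ⟨j, hj⟩ := corner_part hd (hS _) (hT _) hfC
  have hnot : ∀ {x l l'}, x ∈ P l → l' ≠ l → x ∉ P l' := fun hx hl hx' =>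
    (Finset.disjoint_left.1 (hdis _ _ hl)) hx' hx
  have hne : ∀ c : Fin (m + 2), f c.castSucc ≠ f (Fin.last _) := fun c h =>
    (Fin.castSucc_lt_last c).ne (hinj h)
  have hdp := fun t => diag_part hd (hS _) (hnot hfC (hne t)) t (hfD t) j
    (fun c => hnot (hj c) (hne t))
  have hζ : ∀ t : Fin (m + 2), iz (P (f t.castSucc)) (pC m d) = 0 := fun t =>
    iz_zero (hnot hfC (hne t))
  have hcs : ∀ c : Fin (m + 1), c.succ ≠ c.castSucc := fun c => (Fin.castSucc_lt_succ).ne'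
  refine ⟨j, Equiv.ofBijective f (Finite.injective_iff_bijective.1 hinj), ?_, ?_, ?_, ?_⟩
  · intro c; exact hfD c
  · intro c k
    by_cases hk : k = j
    · subst hk
      simpa [pA] using hj c
    · have := (hdp c).1 k hk
      simpa [pA, Ne.symm hk] using this
  · intro c k
    apply mem_of_iz
    by_cases hk : k = j
    · subst hk
      have e : (Equiv.ofBijective f (Finite.injective_iff_bijective.1 hinj)) (pB m d c k k)
        = f c.succ.castSucc := by simp [pB]
      rw [e]
      have h1 := hT (f c.succ.castSucc) c k
      rw [hζ, (hdp c.succ).2.1, iz_zero (hnot (hj c.castSucc) (hne _)),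
        iz_zero (hnot (hj c.succ) (hne _))] at h1
      nlinarith
    · have e : (Equiv.ofBijective f (Finite.injective_iff_bijective.1 hinj)) (pB m d c k j)
        = f c.castSucc.castSucc := by simp [pB, Ne.symm hk]
      rw [e]
      have h1 := hT (f c.castSucc.castSucc) c k
      have h2 := (hdp c.castSucc).2.2 c.succ (hcs c)
      rw [hζ, h2.1, iz_zero (h2.2 k), iz_one ((hdp c.castSucc).1 k hk)] at h1
      nlinarith
  · exact hfC

end core

section repr
variable {m d : ℕ}

noncomputable def Lu (m d : ℕ) (ε : ℝ) (i : ℕ) (k : Fin d) : ℝ :=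
  uu (m + 3) d ε i (k + 1) - (∑ k : Fin d, uu (m + 3) d ε i (k + 1)) / ((d:ℝ) - 1)

lemma sum_Icc_fin (f : ℕ → ℝ) (N : ℕ) : ∑ k ∈ Finset.Icc 1 N, f k = ∑ k : Fin N, f (k + 1) := by
  rw [← Finset.sum_range (fun k => f (k + 1)), Finset.range_eq_Ico, Finset.sum_Ico_add' f 0 N 1]
  rfl

lemma Lu_zero (ε : ℝ) (k : Fin d) : Lu m d ε 0 k = 0 := by simp [Lu, uu]

lemma uu_rec (hd : 2 ≤ d) (ε : ℝ) (i : ℕ) (k : Fin d) :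
    uu (m + 3) d ε (i + 1) (k + 1) = rr (m + 3) d ε (i + 1) (k + 1) + Lu m d ε i k := by
  have hD : (2:ℝ) ≤ d := by exact_mod_cast hd
  have hD1 : (d:ℝ) - 1 ≠ 0 := by linarith
  cases i with
  | zero => rw [Lu_zero]; simp [uu]
  | succ i =>
    have hmem : (k:ℕ) + 1 ∈ Finset.Icc 1 d := by
      simp
    have h := Finset.add_sum_erase (Finset.Icc 1 d) (fun k => uu (m + 3) d ε (i + 1) k) hmem
    rw [sum_Icc_fin] at h
    rw [uu, Lu, ← h, Finset.sum_neg_distrib]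
    field_simp
    ring

lemma xiT_eq (hd : 2 ≤ d) (ε : ℝ) (k : Fin d) :
    xiT (m + 3) d ε (k + 1) = Lu m d ε (m + 1) k := by
  unfold xiT
  have : m + 3 - 1 = (m + 1) + 1 := rfl
  rw [this, uu_rec hd]; ring

lemma zT_eq (hd : 2 ≤ d) (ε : ℝ) :
    zT (m + 3) d ε = ∑ c : Fin (m + 1), (∑ k : Fin d, uu (m + 3) d ε (c + 1) (k + 1)) / ((d:ℝ) - 1) := by
  unfold zT
  have h0 : 0 < d := by omega
  have hx := xiT_eq (m := m) hd ε ⟨0, h0⟩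
  have hx' : xiT (m + 3) d ε 1 = Lu m d ε (m + 1) ⟨0, h0⟩ := hx
  rw [hx', sum_Icc_fin (fun i => rr (m + 3) d ε i 1)]
  have e : m + 3 - 2 = m + 1 := rfl
  rw [e]
  have h1 : ∀ c : Fin (m + 1), rr (m + 3) d ε (c + 1) 1 =
      uu (m + 3) d ε (c + 1) 1 - Lu m d ε c ⟨0, h0⟩ := by
    intro c
    have := uu_rec (m := m) hd ε c ⟨0, h0⟩
    simp only [zero_add] at this
    rw [this]; ring
  simp only [h1]
  rw [Finset.sum_sub_distrib]
  have h2 : ∑ c : Fin (m + 1), Lu m d ε c ⟨0, h0⟩ + Lu m d ε (m + 1) ⟨0, h0⟩ =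
      ∑ c : Fin (m + 1), Lu m d ε (c + 1) ⟨0, h0⟩ := by
    have a1 := Fin.sum_univ_castSucc (fun c : Fin (m + 2) => Lu m d ε c ⟨0, h0⟩)
    have a2 := Fin.sum_univ_succ (fun c : Fin (m + 2) => Lu m d ε c ⟨0, h0⟩)
    simp only [Fin.val_castSucc, Fin.val_last, Fin.val_succ, Fin.val_zero, Lu_zero, zero_add] at a1 a2
    rw [← a1, a2]
  rw [sub_sub, h2, ← Finset.sum_sub_distrib]
  refine Finset.sum_congr rfl fun c _ => ?_
  simp only [Lu, zero_add]
  ring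

noncomputable def wt (m d : ℕ) (c : Fin (m + 2)) : ℝ := 1 / (d:ℝ) ^ (m + 2 - (c:ℕ))

lemma tensorS_eq (hd : 2 ≤ d) (h) (x : Fin d → Fin (m + 3)) : tensorS (m + 3) d h x =
    (∑ c : Fin (m + 2), if x = pD m d c then 1 - wt m d c else 0)
    + (∑ c : Fin (m + 2), ∑ j : Fin d, if x = pA m d c j then wt m d c / ((d:ℝ) - 1) else 0)
    + (if x = pC m d then 1 - ∑ c : Fin (m + 2), wt m d c / ((d:ℝ) - 1) else 0) := by
  have e1 : ∀ c : Fin (m + 2), 1 - wt m d c =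
      ((d:ℝ) ^ (m + 3 - 1 - (c:ℕ)) - 1) / (d:ℝ) ^ (m + 3 - 1 - (c:ℕ)) := by
    intro c
    have : (d:ℝ) ^ (m + 2 - (c:ℕ)) ≠ 0 := by positivity
    show 1 - 1 / (d:ℝ) ^ (m + 2 - (c:ℕ)) =
      ((d:ℝ) ^ (m + 2 - (c:ℕ)) - 1) / (d:ℝ) ^ (m + 2 - (c:ℕ))
    field_simp
  have e2 : ∀ c : Fin (m + 2), wt m d c / ((d:ℝ) - 1) =
      (1 / ((d : ℝ) - 1)) * (1 / (d : ℝ) ^ (m + 3 - 1 - (c : ℕ))) := by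
    intro c
    show 1 / (d:ℝ) ^ (m + 2 - (c:ℕ)) / ((d:ℝ) - 1) =
      (1 / ((d : ℝ) - 1)) * (1 / (d : ℝ) ^ (m + 2 - (c : ℕ)))
    ring
  simp only [e1, e2]
  unfold tensorS
  rw [Finset.sum_range (n := m + 3 - 1)]
  rfl

lemma tensorT_eq (ε : ℝ) (h) (x : Fin d → Fin (m + 3)) : tensorT (m + 3) d ε h x =
    (∑ c : Fin (m + 1), ∑ j : Fin d, if x = pA m d c.castSucc j then
      -(rr (m + 3) d ε (c + 1) (j + 1)) else 0)
    + (∑ c : Fin (m + 1), ∑ j : Fin d, if x = pB m d c j then uu (m + 3) d ε (c + 1) (j + 1) else 0)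
    + (∑ j : Fin d, if x = pA m d (Fin.last (m + 1)) j then xiT (m + 3) d ε (j + 1) else 0)
    + (if x = pC m d then zT (m + 3) d ε else 0) := by
  rfl

lemma sum_ind (Q : Finset (Fin d → Fin (m + 3))) (p) (v : ℝ) :
    ∑ x ∈ Q, (if x = p then v else 0) = (iz Q p : ℝ) * v := by
  rw [Finset.sum_ite_eq']; simp [iz]

lemma sum_S (hd : 2 ≤ d) (h) (Q : Finset (Fin d → Fin (m + 3))) :
    ∑ x ∈ Q, tensorS (m + 3) d h x =
    (∑ c : Fin (m + 2), (iz Q (pD m d c) : ℝ) * (1 - wt m d c))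
    + (∑ c : Fin (m + 2), (sA Q c : ℝ) * (wt m d c / ((d:ℝ) - 1)))
    + (iz Q (pC m d) : ℝ) * (1 - ∑ c : Fin (m + 2), wt m d c / ((d:ℝ) - 1)) := by
  simp only [tensorS_eq hd]
  rw [Finset.sum_add_distrib, Finset.sum_add_distrib, sum_ind, Finset.sum_comm,
    Finset.sum_comm (s := Q)]
  congr 2
  · exact Finset.sum_congr rfl fun c _ => sum_ind _ _ _
  · refine Finset.sum_congr rfl fun c _ => ?_
    rw [Finset.sum_comm]
    simp only [sum_ind, sA]
    push_cast
    rw [Finset.sum_mul]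

/-- coefficient of `u_{c,k}` in the `T`-sum over `Q` -/
noncomputable def cf (Q : Finset (Fin d → Fin (m + 3))) (p : Fin (m + 1) × Fin d) : ℝ :=
  (iz Q (pB m d p.1 p.2) : ℝ) - iz Q (pA m d p.1.castSucc p.2) + iz Q (pA m d p.1.succ p.2)
    - ((sA Q p.1.succ : ℝ) - iz Q (pC m d)) / ((d:ℝ) - 1)

lemma sum_T (hd : 2 ≤ d) (ε : ℝ) (h) (Q : Finset (Fin d → Fin (m + 3))) :
    ∑ x ∈ Q, tensorT (m + 3) d ε h x =
    ∑ p : Fin (m + 1) × Fin d, cf Q p * uu (m + 3) d ε (p.1 + 1) (p.2 + 1) := by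
  have hsw : ∀ (N : ℕ) (pt : Fin N → Fin d → (Fin d → Fin (m + 3))) (v : Fin N → Fin d → ℝ),
      ∑ x ∈ Q, ∑ c, ∑ j, (if x = pt c j then v c j else 0) =
      ∑ c, ∑ j, (iz Q (pt c j) : ℝ) * v c j := by
    intro N pt v
    rw [Finset.sum_comm]
    refine Finset.sum_congr rfl fun c _ => ?_
    rw [Finset.sum_comm]
    exact Finset.sum_congr rfl fun c _ => sum_ind _ _ _
  simp only [tensorT_eq]
  rw [Finset.sum_add_distrib, Finset.sum_add_distrib, Finset.sum_add_distrib, sum_ind,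
    hsw (m + 1) (fun c j => pA m d c.castSucc j), hsw (m + 1) (fun c j => pB m d c j),
    Finset.sum_comm (s := Q)]
  simp only [sum_ind, xiT_eq hd]
  have hr : ∀ (c : Fin (m + 1)) (j : Fin d), rr (m + 3) d ε (c + 1) (j + 1) =
      uu (m + 3) d ε (c + 1) (j + 1) - Lu m d ε c j := fun c j => by rw [uu_rec hd]; ring
  simp only [hr]
  have a1 := Fin.sum_univ_castSucc (fun c : Fin (m + 2) => ∑ j, (iz Q (pA m d c j) : ℝ) * Lu m d ε c j)
  have a2 := Fin.sum_univ_succ (fun c : Fin (m + 2) => ∑ j, (iz Q (pA m d c j) : ℝ) * Lu m d ε c j)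
  simp only [Fin.val_castSucc, Fin.val_last, Fin.val_succ, Fin.val_zero, Lu_zero, mul_zero,
    Finset.sum_const_zero, zero_add] at a1 a2
  rw [a1] at a2
  have a3 : ∑ j, (iz Q (pA m d (Fin.last (m + 1)) j) : ℝ) * Lu m d ε (m + 1) j =
    ∑ c : Fin (m + 1), (∑ j, (iz Q (pA m d c.succ j) : ℝ) * Lu m d ε (c + 1) j
      - ∑ j, (iz Q (pA m d c.castSucc j) : ℝ) * Lu m d ε c j) := by
    rw [Finset.sum_sub_distrib]; linarith
  rw [a3, zT_eq hd, Finset.mul_sum, ← Finset.sum_add_distrib, ← Finset.sum_add_distrib,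
    ← Finset.sum_add_distrib, Fintype.sum_prod_type]
  refine Finset.sum_congr rfl fun c _ => ?_
  have a4 : ∑ j, (iz Q (pA m d c.succ j) : ℝ) * Lu m d ε (c + 1) j =
      ∑ j, ((iz Q (pA m d c.succ j) : ℝ) - (sA Q c.succ : ℝ) / ((d:ℝ) - 1))
        * uu (m + 3) d ε (c + 1) (j + 1) := by
    simp only [Lu, mul_sub, sub_mul]
    rw [Finset.sum_sub_distrib, Finset.sum_sub_distrib, ← Finset.sum_mul, ← Finset.mul_sum]
    simp only [sA]
    push_cast
    ring
  rw [a4, Finset.sum_div, Finset.mul_sum, ← Finset.sum_add_distrib, ← Finset.sum_sub_distrib,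
    ← Finset.sum_add_distrib, ← Finset.sum_add_distrib]
  refine Finset.sum_congr rfl fun j _ => ?_
  simp only [cf]
  ring

lemma condT_of_cf (hd : 2 ≤ d) {Q : Finset (Fin d → Fin (m + 3))} (h : ∀ p, cf Q p = 0) :
    condT Q := by
  have hD : (2:ℝ) ≤ d := by exact_mod_cast hd
  have hD1 : (d:ℝ) - 1 ≠ 0 := by linarith
  intro c k
  have := h (c, k)
  simp only [cf] at this
  have h2 : (((d:ℤ) - 1) * iz Q (pB m d c k) : ℝ)
    = ((d:ℤ) - 1) * (iz Q (pA m d c.castSucc k) - iz Q (pA m d c.succ k))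
      + sA Q c.succ - iz Q (pC m d) := by
    field_simp at this
    push_cast
    linarith
  exact_mod_cast h2

lemma condS_of_sum (hd : 2 ≤ d) {h} {Q : Finset (Fin d → Fin (m + 3))}
    (hs : ∑ x ∈ Q, tensorS (m + 3) d h x = 1) : condS Q := by
  have hD : (2:ℝ) ≤ d := by exact_mod_cast hd
  have hD1 : (d:ℝ) - 1 ≠ 0 := by linarith
  have hp : (d:ℝ) ^ (m + 2) ≠ 0 := by positivity
  have hw : ∀ c : Fin (m + 2), wt m d c = (d:ℝ) ^ (c:ℕ) / (d:ℝ) ^ (m + 2) := by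
    intro c
    have h1 : (d:ℝ) ^ (m + 2) = (d:ℝ) ^ (m + 2 - (c:ℕ)) * (d:ℝ) ^ (c:ℕ) := by
      rw [← pow_add]; congr 1; have := c.isLt; omega
    rw [wt, h1]
    field_simp
  rw [sum_S hd] at hs
  have h2 := congrArg (fun y => y * (((d:ℝ) - 1) * (d:ℝ) ^ (m + 2))) hs
  simp only [add_mul, Finset.sum_mul, one_mul] at h2
  have h3 : ∑ c : Fin (m + 2), (iz Q (pD m d c) : ℝ) * (((d:ℝ) - 1) * ((d:ℝ) ^ (m + 2) - (d:ℝ) ^ (c:ℕ)))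
    + ∑ c : Fin (m + 2), (sA Q c : ℝ) * (d:ℝ) ^ (c:ℕ)
    + (iz Q (pC m d) : ℝ) * (((d:ℝ) - 1) * (d:ℝ) ^ (m + 2) - ∑ c : Fin (m + 2), (d:ℝ) ^ (c:ℕ))
    = ((d:ℝ) - 1) * (d:ℝ) ^ (m + 2) := by
    refine Eq.trans ?_ h2
    congr 1
    · congr 1
      · refine Finset.sum_congr rfl fun c _ => ?_
        rw [hw]; field_simp
      · refine Finset.sum_congr rfl fun c _ => ?_
        rw [hw]; field_simp
    · have h4 : (∑ c : Fin (m + 2), wt m d c / ((d:ℝ) - 1)) * (((d:ℝ) - 1) * (d:ℝ) ^ (m + 2)) =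
          ∑ c : Fin (m + 2), (d:ℝ) ^ (c:ℕ) := by
        rw [Finset.sum_mul]
        refine Finset.sum_congr rfl fun c _ => ?_
        rw [hw]; field_simp
      rw [← h4]
      ring
  unfold condS
  exact_mod_cast h3

lemma sum_univ_S (hd : 2 ≤ d) (h) : ∑ x, tensorS (m + 3) d h x = m + 3 := by
  have hD : (2:ℝ) ≤ d := by exact_mod_cast hd
  have hD1 : (d:ℝ) - 1 ≠ 0 := by linarith
  rw [sum_S hd]
  simp only [sA, iz, Finset.mem_univ, if_true]
  push_cast
  simp only [Finset.sum_sub_distrib, ← Finset.mul_sum, ← Finset.sum_div, one_mul]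
  simp
  field_simp
  ring

lemma sum_univ_T (hd : 2 ≤ d) (ε : ℝ) (h) : ∑ x, tensorT (m + 3) d ε h x = 0 := by
  have hD : (2:ℝ) ≤ d := by exact_mod_cast hd
  have hD1 : (d:ℝ) - 1 ≠ 0 := by linarith
  rw [sum_T hd]
  apply Finset.sum_eq_zero
  intro p _
  have : cf (Finset.univ : Finset (Fin d → Fin (m + 3))) p = 0 := by
    simp [cf, sA, iz, div_self hD1]
  rw [this, zero_mul]

end repr

section analytic
open Filter Topology Asymptotics
variable {m d : ℕ}

lemma tendsto_zpow_zero {p : ℤ} (h : 0 < p) :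
    Tendsto (fun ε : ℝ => ε ^ p) (𝓝[>] 0) (𝓝 0) := by
  lift p to ℕ using h.le
  have hp : p ≠ 0 := by rintro rfl; simp at h
  have : Tendsto (fun ε : ℝ => ε ^ p) (𝓝 0) (𝓝 (0 ^ p)) := (continuous_pow p).tendsto 0
  rw [zero_pow hp] at this
  simpa using this.mono_left nhdsWithin_le_nhds

lemma zpow_littleO {p q : ℤ} (h : q < p) :
    (fun ε : ℝ => ε ^ p) =o[𝓝[>] 0] (fun ε : ℝ => ε ^ q) := by
  refine (isLittleO_iff_exists_eq_mul).2 ⟨fun ε => ε ^ (p - q), tendsto_zpow_zero (by omega), ?_⟩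
  filter_upwards [self_mem_nhdsWithin] with ε hε
  have : ε ≠ 0 := ne_of_gt hε
  simp only [Pi.mul_apply]
  rw [← zpow_add₀ this]
  congr 1; ring

def ex (m d : ℕ) (i : ℕ) (k : Fin d) : ℤ :=
  (d:ℤ) * (((m + 3 : ℕ) : ℤ) - 1) - d * ((i + 1 : ℕ) : ℤ) - ((k + 1 : ℕ) : ℤ) + 1

lemma rr_eq (ε : ℝ) (i : ℕ) (k : Fin d) : rr (m + 3) d ε (i + 1) (k + 1) = ε ^ ex m d i k := rfl

lemma ex_lt {i : ℕ} (k k' : Fin d) : ex m d (i + 1) k < ex m d i k' := by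
  unfold ex
  have := k.isLt
  have := k'.isLt
  push_cast
  nlinarith

lemma ex_lt' {i : ℕ} {k k' : Fin d} (h : k' < k) : ex m d i k < ex m d i k' := by
  unfold ex
  have : (k':ℕ) < k := h
  push_cast
  have : ((k':ℕ):ℤ) < (k:ℕ) := by exact_mod_cast h
  linarith

lemma ex_lt_of_lt {i i' : ℕ} (h : i < i') (k k' : Fin d) : ex m d i' k < ex m d i k' := by
  induction i', h using Nat.le_induction with
  | base => exact ex_lt k k'
  | succ n _ ih => exact (ex_lt k k).trans ih

lemma ex_pos (i : Fin (m + 1)) (k : Fin d) : 0 < ex m d i k := by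
  unfold ex
  have h1 : ((i:ℕ):ℤ) ≤ m := by have := i.isLt; omega
  have h2 : ((k:ℕ):ℤ) < d := by exact_mod_cast k.isLt
  push_cast
  have h3 : (d:ℤ) * i ≤ d * m := mul_le_mul_of_nonneg_left h1 (by positivity)
  nlinarith

lemma ex_inj {p q : Fin (m + 1) × Fin d} (h : ex m d p.1 p.2 = ex m d q.1 q.2) : p = q := by
  obtain ⟨i, k⟩ := p
  obtain ⟨i', k'⟩ := q
  simp only at h
  rcases lt_trichotomy i i' with h1 | h1 | h1
  · exact absurd h (ex_lt_of_lt h1 k' k).ne'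
  · subst h1
    rcases lt_trichotomy k k' with h2 | h2 | h2
    · exact absurd h (ex_lt' h2).ne'
    · rw [h2]
    · exact absurd h (ex_lt' h2).ne
  · exact absurd h (ex_lt_of_lt h1 k k').ne

lemma uu_equiv (hd : 2 ≤ d) (i : ℕ) : ∀ k : Fin d,
    (fun ε => uu (m + 3) d ε (i + 1) (k + 1)) ~[𝓝[>] 0] (fun ε => ε ^ ex m d i k) := by
  induction i with
  | zero =>
    intro k
    have : (fun ε => uu (m + 3) d ε (0 + 1) (k + 1)) = (fun ε => ε ^ ex m d 0 k) := by
      funext ε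
      rw [uu_rec hd, Lu_zero, add_zero, rr_eq]
    rw [this]
  | succ i ih =>
    intro k
    have h1 : ∀ k' : Fin d, (fun ε => uu (m + 3) d ε (i + 1) (k' + 1)) =o[𝓝[>] 0]
        (fun ε => ε ^ ex m d (i + 1) k) := fun k' =>
      (ih k').isBigO.trans_isLittleO (zpow_littleO (ex_lt k k'))
    have h2 : (fun ε => Lu m d ε (i + 1) k) =o[𝓝[>] 0] (fun ε => ε ^ ex m d (i + 1) k) := by
      unfold Lu
      refine (h1 k).sub ?_
      simp only [div_eq_inv_mul]
      have h3 := (IsLittleO.sum (s := Finset.univ) fun k' _ => h1 k').const_mul_left ((d:ℝ) - 1)⁻¹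
      simpa only [Finset.sum_apply] using h3
    unfold IsEquivalent
    refine h2.congr' (Eventually.of_forall fun ε => ?_) EventuallyEq.rfl
    simp only [Pi.sub_apply]
    rw [uu_rec hd, rr_eq]; ring

lemma uu_tendsto (hd : 2 ≤ d) (p : Fin (m + 1) × Fin d) :
    Tendsto (fun ε => uu (m + 3) d ε (p.1 + 1) (p.2 + 1)) (𝓝[>] 0) (𝓝 0) :=
  (uu_equiv hd p.1 p.2).symm.tendsto_nhds (tendsto_zpow_zero (ex_pos p.1 p.2))

lemma uu_pos (hd : 2 ≤ d) (p : Fin (m + 1) × Fin d) :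
    ∀ᶠ ε in 𝓝[>] 0, 0 ≤ uu (m + 3) d ε (p.1 + 1) (p.2 + 1) := by
  obtain ⟨φ, hφ, he⟩ := (uu_equiv (m := m) hd p.1 p.2).exists_eq_mul
  filter_upwards [he, hφ.eventually (lt_mem_nhds zero_lt_one), self_mem_nhdsWithin] with ε h1 h2 h3
  rw [h1]
  have : 0 < ε := h3
  simp only [Pi.mul_apply]
  positivity

lemma sumT_tendsto (hd : 2 ≤ d) (h) (Q : Finset (Fin d → Fin (m + 3))) :
    Tendsto (fun ε => ∑ x ∈ Q, tensorT (m + 3) d ε h x) (𝓝[>] 0) (𝓝 0) := by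
  simp only [sum_T hd]
  have : Tendsto (fun ε => ∑ p : Fin (m + 1) × Fin d, cf Q p * uu (m + 3) d ε (p.1 + 1) (p.2 + 1))
      (𝓝[>] 0) (𝓝 (∑ p : Fin (m + 1) × Fin d, cf Q p * 0)) :=
    tendsto_finsetSum _ fun p _ => (uu_tendsto hd p).const_mul _
  simpa using this

lemma ev_cf (hd : 2 ≤ d) (h) (Q : Finset (Fin d → Fin (m + 3))) :
    ∀ᶠ ε in 𝓝[>] 0, ∑ x ∈ Q, tensorT (m + 3) d ε h x = 0 → ∀ p, cf Q p = 0 := by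
  by_cases hall : ∀ p, cf Q p = 0
  · exact Eventually.of_forall fun _ _ => hall
  push Not at hall
  obtain ⟨p1, hp1⟩ := hall
  obtain ⟨p0, hp0, hmin⟩ := Finset.exists_min_image
    (Finset.univ.filter fun p : Fin (m + 1) × Fin d => cf Q p ≠ 0)
    (fun p => ex m d p.1 p.2) ⟨p1, by simpa using hp1⟩
  simp only [Finset.mem_filter, Finset.mem_univ, true_and] at hp0 hmin
  have h1 : ∀ p ∈ Finset.univ.erase p0,
      (fun ε => cf Q p * uu (m + 3) d ε (p.1 + 1) (p.2 + 1)) =o[𝓝[>] 0]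
        (fun ε : ℝ => ε ^ ex m d p0.1 p0.2) := by
    intro p hp
    by_cases hz : cf Q p = 0
    · simp only [hz, zero_mul]; exact isLittleO_zero _ _
    · have hlt : ex m d p0.1 p0.2 < ex m d p.1 p.2 :=
        lt_of_le_of_ne (hmin p hz) fun he => (Finset.ne_of_mem_erase hp) (ex_inj he).symm
      exact ((uu_equiv hd p.1 p.2).isBigO.trans_isLittleO (zpow_littleO hlt)).const_mul_left _
  have h2 := IsLittleO.sum h1
  have h3 : Tendsto (fun ε : ℝ => (∑ x ∈ Q, tensorT (m + 3) d ε h x) / ε ^ ex m d p0.1 p0.2)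
      (𝓝[>] 0) (𝓝 (cf Q p0)) := by
    obtain ⟨φ, hφ, he⟩ := (uu_equiv (m := m) hd p0.1 p0.2).exists_eq_mul
    have h4 := (hφ.const_mul (cf Q p0)).add h2.tendsto_div_nhds_zero
    rw [mul_one, add_zero] at h4
    refine h4.congr' ?_
    filter_upwards [he, self_mem_nhdsWithin] with ε h5 h6
    have : ε ^ ex m d p0.1 p0.2 ≠ 0 := zpow_ne_zero _ (ne_of_gt h6)
    rw [sum_T hd, ← Finset.add_sum_erase _ _ (Finset.mem_univ p0), h5, add_div]
    simp only [Pi.mul_apply, Finset.sum_apply]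
    field_simp
  filter_upwards [h3.eventually_ne hp0] with ε h7 h8
  rw [h8] at h7
  simp at h7

lemma wt_pos (hd : 2 ≤ d) (c : Fin (m + 2)) : 0 < wt m d c := by
  have : (0:ℝ) < d := by exact_mod_cast (by omega : 0 < d)
  unfold wt; positivity

lemma wt_lt (hd : 2 ≤ d) (c : Fin (m + 2)) : wt m d c < 1 := by
  have h : (1:ℝ) < d := by exact_mod_cast (by omega : 1 < d)
  have : 1 < (d:ℝ) ^ (m + 2 - (c:ℕ)) := one_lt_pow₀ h (by have := c.isLt; omega)
  unfold wt
  rw [div_lt_one (by linarith)]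
  exact this

lemma corner_pos (hd : 2 ≤ d) : 0 < 1 - ∑ c : Fin (m + 2), wt m d c / ((d:ℝ) - 1) := by
  have hD : (2:ℝ) ≤ d := by exact_mod_cast hd
  have hp : (0:ℝ) < (d:ℝ) ^ (m + 2) := by positivity
  have h1 : ∀ c : Fin (m + 2), wt m d c / ((d:ℝ) - 1) ≤ (d:ℝ) ^ (c:ℕ) / (d:ℝ) ^ (m + 2) := by
    intro c
    have h1 : (d:ℝ) ^ (m + 2) = (d:ℝ) ^ (m + 2 - (c:ℕ)) * (d:ℝ) ^ (c:ℕ) := by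
      rw [← pow_add]; congr 1; have := c.isLt; omega
    have h2 : wt m d c = (d:ℝ) ^ (c:ℕ) / (d:ℝ) ^ (m + 2) := by
      rw [wt, h1]; field_simp
    rw [← h2]
    exact div_le_self (wt_pos hd c).le (by linarith)
  have h2 := Finset.sum_le_sum fun c (_ : c ∈ (Finset.univ : Finset (Fin (m + 2)))) => h1 c
  rw [← Finset.sum_div (f := fun c : Fin (m + 2) => (d:ℝ) ^ (c:ℕ))] at h2
  have h3 : ∑ c : Fin (m + 2), (d:ℝ) ^ (c:ℕ) ≤ (d:ℝ) ^ (m + 2) - 1 := by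
    exact_mod_cast geomFin_le (m := m) hd
  have h4 : (∑ c : Fin (m + 2), (d:ℝ) ^ (c:ℕ)) / (d:ℝ) ^ (m + 2) < 1 := by
    rw [div_lt_one hp]; linarith
  linarith

lemma S_parts (hd : 2 ≤ d) (x : Fin d → Fin (m + 3)) :
    (0 ≤ ∑ c : Fin (m + 2), if x = pD m d c then 1 - wt m d c else 0) ∧
    (0 ≤ ∑ c : Fin (m + 2), ∑ j : Fin d, if x = pA m d c j then wt m d c / ((d:ℝ) - 1) else 0) ∧
    (0 ≤ if x = pC m d then 1 - ∑ c : Fin (m + 2), wt m d c / ((d:ℝ) - 1) else 0) := by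
  have hD : (2:ℝ) ≤ d := by exact_mod_cast hd
  refine ⟨Finset.sum_nonneg fun c _ => ?_,
    Finset.sum_nonneg fun c _ => Finset.sum_nonneg fun j _ => ?_, ?_⟩
  · split_ifs
    · linarith [wt_lt hd c]
    · rfl
  · split_ifs
    · exact div_nonneg (wt_pos hd c).le (by linarith)
    · rfl
  · split_ifs
    · exact (corner_pos hd).le
    · rfl

lemma S_nonneg (hd : 2 ≤ d) (h) (x : Fin d → Fin (m + 3)) : 0 ≤ tensorS (m + 3) d h x := by
  rw [tensorS_eq hd]
  obtain ⟨h1, h2, h3⟩ := S_parts hd x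
  linarith

lemma S_pos_D (hd : 2 ≤ d) (h) (c : Fin (m + 2)) : 0 < tensorS (m + 3) d h (pD m d c) := by
  rw [tensorS_eq hd]
  obtain ⟨h1, h2, h3⟩ := S_parts hd (pD m d c)
  have : 0 < ∑ c' : Fin (m + 2), if pD m d c = pD m d c' then 1 - wt m d c' else 0 := by
    refine Finset.sum_pos' (fun c' _ => ?_) ⟨c, Finset.mem_univ c, ?_⟩
    · split_ifs
      · linarith [wt_lt hd c']
      · rfl
    · rw [if_pos rfl]; linarith [wt_lt hd c]
  linarith

lemma S_pos_A (hd : 2 ≤ d) (h) (c : Fin (m + 2)) (k : Fin d) :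
    0 < tensorS (m + 3) d h (pA m d c k) := by
  have hD : (2:ℝ) ≤ d := by exact_mod_cast hd
  rw [tensorS_eq hd]
  obtain ⟨h1, h2, h3⟩ := S_parts hd (pA m d c k)
  have hnn : ∀ c' j, 0 ≤ if pA m d c k = pA m d c' j then wt m d c' / ((d:ℝ) - 1) else 0 := by
    intro c' j
    split_ifs
    · exact div_nonneg (wt_pos hd c').le (by linarith)
    · rfl
  have : 0 < ∑ c' : Fin (m + 2), ∑ j : Fin d,
      if pA m d c k = pA m d c' j then wt m d c' / ((d:ℝ) - 1) else 0 := by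
    refine Finset.sum_pos' (fun c' _ => Finset.sum_nonneg fun j _ => hnn _ _)
      ⟨c, Finset.mem_univ c, Finset.sum_pos' (fun j _ => hnn _ _) ⟨k, Finset.mem_univ k, ?_⟩⟩
    rw [if_pos rfl]
    exact div_pos (wt_pos hd c) (by linarith)
  linarith

lemma S_pos_C (hd : 2 ≤ d) (h) : 0 < tensorS (m + 3) d h (pC m d) := by
  rw [tensorS_eq hd]
  obtain ⟨h1, h2, h3⟩ := S_parts hd (pC m d)
  have : 0 < if pC m d = pC m d then 1 - ∑ c : Fin (m + 2), wt m d c / ((d:ℝ) - 1) else 0 := by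
    rw [if_pos rfl]; exact corner_pos hd
  linarith

lemma T_of_S_zero (hd : 2 ≤ d) (h) (ε : ℝ) (x : Fin d → Fin (m + 3))
    (hx : tensorS (m + 3) d h x = 0) : tensorT (m + 3) d ε h x =
      ∑ c : Fin (m + 1), ∑ j : Fin d, if x = pB m d c j then uu (m + 3) d ε (c + 1) (j + 1) else 0 := by
  have hA : ∀ c k, x ≠ pA m d c k := fun c k he => by
    have := S_pos_A hd h c k
    rw [← he, hx] at this; exact lt_irrefl _ this
  have hC : x ≠ pC m d := fun he => by
    have := S_pos_C (m := m) hd h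
    rw [← he, hx] at this; exact lt_irrefl _ this
  rw [tensorT_eq]
  simp [hA, hC]

lemma T_single (hd : 2 ≤ d) (h) (x : Fin d → Fin (m + 3)) :
    Tendsto (fun ε => tensorT (m + 3) d ε h x) (𝓝[>] 0) (𝓝 0) := by
  simpa using sumT_tendsto hd h {x}

lemma ev_pos (hd : 2 ≤ d) (h) (x : Fin d → Fin (m + 3)) (hx : 0 < tensorS (m + 3) d h x) :
    ∀ᶠ ε in 𝓝[>] 0, 0 < tensorS (m + 3) d h x + tensorT (m + 3) d ε h x := by
  have := (T_single hd h x).const_add (tensorS (m + 3) d h x)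
  rw [add_zero] at this
  exact this.eventually (lt_mem_nhds hx)

lemma ev_nonneg (hd : 2 ≤ d) (h) (x : Fin d → Fin (m + 3)) :
    ∀ᶠ ε in 𝓝[>] 0, 0 ≤ tensorS (m + 3) d h x + tensorT (m + 3) d ε h x := by
  rcases (S_nonneg hd h x).lt_or_eq with hx | hx
  · exact (ev_pos hd h x hx).mono fun _ h => h.le
  · filter_upwards [eventually_all.2 (uu_pos (m := m) hd)] with ε hu
    rw [← hx, zero_add, T_of_S_zero hd h ε x hx.symm]
    refine Finset.sum_nonneg fun c _ => Finset.sum_nonneg fun j _ => ?_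
    split_ifs
    · exact hu (c, j)
    · rfl

lemma ev_sum (hd : 2 ≤ d) (h) (Q : Finset (Fin d → Fin (m + 3))) :
    ∀ᶠ ε in 𝓝[>] 0, ∑ x ∈ Q, (tensorS (m + 3) d h x + tensorT (m + 3) d ε h x) = 1 →
      ∑ x ∈ Q, tensorS (m + 3) d h x = 1 := by
  by_cases hq : ∑ x ∈ Q, tensorS (m + 3) d h x = 1
  · exact Eventually.of_forall fun _ _ => hq
  · have := (sumT_tendsto hd h Q).const_add (∑ x ∈ Q, tensorS (m + 3) d h x)
    rw [add_zero] at this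
    filter_upwards [this.eventually_ne hq] with ε h1 h2
    rw [Finset.sum_add_distrib] at h2
    exact absurd h2 h1

lemma special (hd : 2 ≤ d) (h) (ε : ℝ) (x : Fin d → Fin (m + 3))
    (hx : tensorS (m + 3) d h x + tensorT (m + 3) d ε h x ≠ 0) :
    (∃ c, x = pD m d c) ∨ (∃ c k, x = pA m d c k) ∨ (∃ c k, x = pB m d c k) ∨ x = pC m d := by
  by_contra hn
  push Not at hn
  obtain ⟨h1, h2, h3, h4⟩ := hn
  apply hx
  rw [tensorS_eq hd, tensorT_eq]
  simp [h1, h2, h3, h4]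

end analytic

theorem stmt_18 (n d : ℕ) (hn : 4 ≤ n) (hd : 2 ≤ d) :
    ∃ ε₀ : ℝ, 0 < ε₀ ∧ ∀ ε : ℝ, ∀ hε0 : 0 < ε, ∀ hε1 : ε < ε₀,
      (∀ x : Fin d → Fin n,
        0 ≤ tensorS n d (by omega) x + tensorT n d ε (by omega) x) ∧
      ∀ P : Fin n → Finset (Fin d → Fin n),
        (∀ l l', l ≠ l' → Disjoint (P l) (P l')) →
        (Finset.univ.biUnion P = Finset.univ.filter
          (fun x => tensorS n d (by omega) x + tensorT n d ε (by omega) x ≠ 0)) →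
        (∀ l l',
          ∑ x ∈ P l, (tensorS n d (by omega) x + tensorT n d ε (by omega) x) =
          ∑ x ∈ P l', (tensorS n d (by omega) x + tensorT n d ε (by omega) x)) →
        ∃ (j : Fin d) (σ : Equiv.Perm (Fin n)), ∀ i : Fin n,
          P (σ i) = Finset.univ.filter
            (fun x => (tensorS n d (by omega) x + tensorT n d ε (by omega) x ≠ 0)
              ∧ x j = i) := by

  obtain ⟨m, rfl⟩ : ∃ m, n = m + 3 := ⟨n - 3, by omega⟩
  have hh : 1 ≤ m + 3 := by omega
  have E1 := Filter.eventually_all.2 (ev_nonneg (m := m) hd hh)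
  have E2 := Filter.eventually_all.2 fun x => Filter.eventually_all.2 (ev_pos (m := m) hd hh x)
  have E3 := Filter.eventually_all.2 (ev_sum (m := m) hd hh)
  have E4 := Filter.eventually_all.2 (ev_cf (m := m) hd hh)
  have E := E1.and (E2.and (E3.and E4))
  obtain ⟨ε₀, hε₀, hsub⟩ := mem_nhdsGT_iff_exists_Ioo_subset.1 E
  refine ⟨ε₀, hε₀, fun ε hε0 hε1 => ?_⟩
  obtain ⟨F1, F2, F3, F4⟩ := hsub ⟨hε0, hε1⟩
  refine ⟨F1, fun P hdis hun hsum => ?_⟩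
  have hone : ∀ l, ∑ x ∈ P l, (tensorS (m + 3) d hh x + tensorT (m + 3) d ε hh x) = 1 := by
    intro l
    have h1 : ∑ x ∈ Finset.univ.biUnion P, (tensorS (m + 3) d hh x + tensorT (m + 3) d ε hh x) =
        ∑ l', ∑ x ∈ P l', (tensorS (m + 3) d hh x + tensorT (m + 3) d ε hh x) :=
      Finset.sum_biUnion fun a _ b _ hab => hdis a b hab
    rw [hun, Finset.sum_filter_ne_zero, Finset.sum_add_distrib, sum_univ_S hd, sum_univ_T hd,
      Finset.sum_congr rfl (fun l' _ => hsum l' l)] at h1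
    simp only [Finset.sum_const, Finset.card_univ, Fintype.card_fin, nsmul_eq_mul] at h1
    push_cast at h1
    have h2 : (m:ℝ) + 3 ≠ 0 := by positivity
    have h3 : ((m:ℝ) + 3) * 1 = ((m:ℝ) + 3) *
      ∑ x ∈ P l, (tensorS (m + 3) d hh x + tensorT (m + 3) d ε hh x) := by linarith
    exact (mul_left_cancel₀ h2 h3).symm
  have hSum : ∀ l, ∑ x ∈ P l, tensorS (m + 3) d hh x = 1 := fun l => F3 _ (hone l)
  have hTsum : ∀ l, ∑ x ∈ P l, tensorT (m + 3) d ε hh x = 0 := fun l => by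
    have := hone l
    rw [Finset.sum_add_distrib, hSum] at this
    linarith
  have hmem : ∀ x, (∃ l, x ∈ P l) ↔ tensorS (m + 3) d hh x + tensorT (m + 3) d ε hh x ≠ 0 := by
    intro x
    have := congrArg (fun s => x ∈ s) hun
    simpa using this
  have hcov : ∀ i : Fin (m + 3), ∃ l, (fun _ => i) ∈ P l := by
    intro i
    rw [hmem]
    refine (F2 _ ?_).ne'
    induction i using Fin.lastCases with
    | last => exact S_pos_C hd hh
    | cast c => exact S_pos_D hd hh c
  obtain ⟨j, σ, cD, cA, cB, cC⟩ := core hd P hdis hcov (fun l => condS_of_sum hd (hSum l))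
    (fun l => condT_of_cf hd (F4 _ (hTsum l)))
  have hall : ∀ x, tensorS (m + 3) d hh x + tensorT (m + 3) d ε hh x ≠ 0 → x ∈ P (σ (x j)) := by
    intro x hx
    rcases special hd hh ε x hx with ⟨c, rfl⟩ | ⟨c, k, rfl⟩ | ⟨c, k, rfl⟩ | rfl
    · exact cD c
    · exact cA c k
    · exact cB c k
    · exact cC
  refine ⟨j, σ, fun i => ?_⟩
  ext x
  simp only [Finset.mem_filter, Finset.mem_univ, true_and]
  constructor
  · intro hx
    have hx0 := (hmem x).1 ⟨_, hx⟩
    refine ⟨hx0, ?_⟩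
    by_contra hne
    exact Finset.disjoint_left.1 (hdis _ _ (fun h => hne (σ.injective h))) (hall x hx0) hx
  · rintro ⟨hx, rfl⟩
    exact hall x hx
end

section
/- Let M be a finite set of goods, let v be an additive nonnegative valuation on M, let n ≥ 2 be an integer, and let g ∈ M be any good. Then MMS^{n−1}(M \ {g}) ≥ MMS^n(M), where MMS^k denotes the k-maximin share of valuation v. -/
open Finset

noncomputable def mms {G : Type*} [Fintype G] [DecidableEq G]
    (M : Finset G) (w : G → ℝ) (k : ℕ) (hk : 0 < k) : ℝ :=
  Finset.univ.sup' ⟨fun _ => ⟨0, hk⟩, Finset.mem_univ _⟩ fun P : G → Fin k =>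
    Finset.univ.inf' ⟨⟨0, hk⟩, Finset.mem_univ _⟩ fun j : Fin k =>
      ∑ g ∈ M.filter (fun g => P g = j), w g

noncomputable def bval {G : Type*} [Fintype G] {n : ℕ}
    (w : G → ℝ) (A : G → Fin n) (i : Fin n) : ℝ :=
  ∑ g ∈ Finset.univ.filter (fun g => A g = i), w g

theorem stmt_19 {G : Type*} [Fintype G] [DecidableEq G] (M : Finset G)
    (w : G → ℝ) (hw : ∀ g, 0 ≤ w g) (n : ℕ) (hn : 2 ≤ n) (g : G) (hg : g ∈ M) :
    mms M w n (by omega) ≤ mms (M.erase g) w (n - 1) (by omega) := by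
  obtain ⟨m, rfl⟩ : ∃ m, n = m + 2 := ⟨n - 2, by omega⟩
  change mms M w (m + 2) (by omega) ≤ mms (M.erase g) w (m + 1) (by omega)
  unfold mms
  apply Finset.sup'_le
  intro P _
  have hQ : ∀ x, ∃ q : Fin (m + 1), P x ≠ P g → (P g).succAbove q = P x := by
    intro x
    by_cases h : P x = P g
    · exact ⟨0, fun h' => absurd h h'⟩
    · obtain ⟨q, hq⟩ := Fin.exists_succAbove_eq h
      exact ⟨q, fun _ => hq⟩
  choose Q hQ using hQ
  refine le_trans ?_ (Finset.le_sup' _ (Finset.mem_univ Q))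
  apply Finset.le_inf'
  intro j _
  refine le_trans (Finset.inf'_le _ (Finset.mem_univ ((P g).succAbove j))) ?_
  apply Finset.sum_le_sum_of_subset_of_nonneg
  · intro x hx
    rw [Finset.mem_filter] at hx ⊢
    have hne : P x ≠ P g := by
      rw [hx.2]
      exact Fin.succAbove_ne _ _
    refine ⟨Finset.mem_erase.2 ⟨fun h => hne (by rw [h]), hx.1⟩, ?_⟩
    exact Fin.succAbove_right_injective ((hQ x hne).trans hx.2)
  · intro x _ _
    exact hw x
end
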